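/- Elevator squares: let k be a field with char k ≠ 2 and let m be a positive integer whose image in k is nonzero. Let u : Fin m → k be the weight vector of m^{A¹}: if m is odd, one entry m, (m−1)/2 entries 1, and (m−1)/2 entries −1; if m is even, m/2 entries 1 and m/2 entries −1. Then the diagonal quadratic form indexed by Fin m × Fin m with weight u i · u j at (i,j) is equivalent to: the diagonal form with one entry 1, (m²−1)/2 entries 1, and (m²−1)/2 entries −1 grouped as ⟨1⟩ plus (m²−1)/2 hyperbolic pairs, when m is odd; and the split diagonal form with m²/2 entries 1 and m²/2 entries −1, when m is even. -/

import Mathlib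

namespace QuadraticMap

variable {k ι κ : Type*} [Field k] [Fintype ι] [Fintype κ]

/-- Diagonal forms are invariant under reindexing. -/
theorem weightedSumSquares_equivalent_of_equiv {v : ι → k} {w : κ → k} (e : ι ≃ κ)
    (h : ∀ i, w (e i) = v i) :
    (weightedSumSquares k v).Equivalent (weightedSumSquares k w) :=
  ⟨{ LinearEquiv.funCongrLeft k k e.symm with
      map_app' := fun x => by
        simp [weightedSumSquares_apply, ← e.sum_comp, h, LinearEquiv.funCongrLeft_apply,
          LinearMap.funLeft_apply] }⟩

/-- A diagonal form indexed by a sum type is the orthogonal sum of the two diagonal forms. -/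
theorem weightedSumSquares_sumElim_equivalent_prod (v : ι → k) (w : κ → k) :
    (weightedSumSquares k (Sum.elim v w)).Equivalent
      ((weightedSumSquares k v).prod (weightedSumSquares k w)) :=
  ⟨{ LinearEquiv.sumArrowLequivProdArrow ι κ k k with
      map_app' := fun x => by
        simp [weightedSumSquares_apply, LinearEquiv.sumArrowLequivProdArrow,
          Equiv.sumArrowEquivProdArrow] }⟩

theorem weightedSumSquares_sumElim_equivalent {ι' κ' : Type*} [Fintype ι'] [Fintype κ']
    {v : ι → k} {w : κ → k} {v' : ι' → k} {w' : κ' → k}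
    (hv : (weightedSumSquares k v).Equivalent (weightedSumSquares k v'))
    (hw : (weightedSumSquares k w).Equivalent (weightedSumSquares k w')) :
    (weightedSumSquares k (Sum.elim v w)).Equivalent
      (weightedSumSquares k (Sum.elim v' w')) :=
  ((weightedSumSquares_sumElim_equivalent_prod v w).trans (hv.prod hw)).trans
    (weightedSumSquares_sumElim_equivalent_prod v' w').symm

/-- The linear change of coordinates carrying `a x² - a y²` to `x² - y²`, coordinatewise. -/
def hyperbolicEquiv (h2 : (2 : k) ≠ 0) (a : ι → k) (ha : ∀ i, a i ≠ 0) :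
    ((ι → k) × (ι → k)) ≃ₗ[k] ((ι → k) × (ι → k)) where
  toFun x := (fun i => ((a i + 1) * x.1 i + (a i - 1) * x.2 i) / 2,
    fun i => ((a i - 1) * x.1 i + (a i + 1) * x.2 i) / 2)
  invFun x := (fun i => ((x.1 i + x.2 i) / a i + (x.1 i - x.2 i)) / 2,
    fun i => ((x.1 i + x.2 i) / a i - (x.1 i - x.2 i)) / 2)
  map_add' x y := by ext <;> simp <;> ring
  map_smul' r x := by ext <;> simp <;> ring
  left_inv x := by
    ext i <;> have := ha i <;> simp only <;> field_simp <;> ring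
  right_inv x := by
    ext i <;> have := ha i <;> simp only <;> field_simp <;> ring

/-- In characteristic different from two, a sum of binary forms `⟨a, -a⟩` with `a ≠ 0` is a sum of
hyperbolic planes `⟨1, -1⟩`. -/
theorem weightedSumSquares_sumElim_neg_equivalent (h2 : (2 : k) ≠ 0) (a : ι → k)
    (ha : ∀ i, a i ≠ 0) :
    (weightedSumSquares k (Sum.elim a (-a))).Equivalent
      (weightedSumSquares k (Sum.elim (fun _ : ι => (1 : k)) (fun _ : ι => (-1 : k)))) := by
  refine ((weightedSumSquares_sumElim_equivalent_prod _ _).trans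
    ⟨⟨hyperbolicEquiv h2 a ha, ?_⟩⟩).trans (weightedSumSquares_sumElim_equivalent_prod _ _).symm
  intro x
  simp only [hyperbolicEquiv, prod_apply, weightedSumSquares_apply, ← Finset.sum_add_distrib,
   smul_eq_mul, Pi.neg_apply]
  refine Finset.sum_congr rfl fun i _ => ?_
  simp
  field_simp
  ring

/-- A sum of binary forms `⟨a, -a⟩` indexed by a type with `n` elements is `n (⟨1⟩ + ⟨-1⟩)`. -/
theorem weightedSumSquares_sumElim_neg_equivalent_fin (h2 : (2 : k) ≠ 0) (a : ι → k)
    (ha : ∀ i, a i ≠ 0) {n : ℕ} (hn : Fintype.card ι = n) :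
    (weightedSumSquares k (Sum.elim a (-a))).Equivalent
      (weightedSumSquares k (Sum.elim (fun _ : Fin n => (1 : k)) (fun _ : Fin n => (-1 : k)))) := by
  have e := Fintype.equivFinOfCardEq hn
  refine (weightedSumSquares_sumElim_neg_equivalent h2 a ha).trans
    (weightedSumSquares_equivalent_of_equiv (e.sumCongr e) ?_)
  rintro (i | i) <;> rfl

end QuadraticMap


/-- Elevator squares.  For `m` positive with `(m : k) ≠ 0` and `u` the
weight vector of `m^{A¹}`, the tensor square of the diagonal form with weights `u` is
equivalent to `⟨1⟩ + ((m²-1)/2)·(⟨1⟩+⟨-1⟩)` when `m` is odd, and to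
`(m²/2)·(⟨1⟩+⟨-1⟩)` when `m` is even. -/
theorem stmt10 (k : Type) [Field k] (hk : ringChar k ≠ 2)
    (m : ℕ) (hm : 0 < m) (hmk : (m : k) ≠ 0) :
    (∀ c : ℕ, m = 2 * c + 1 →
      (QuadraticMap.weightedSumSquares k
          (fun p : (Fin 1 ⊕ Fin c ⊕ Fin c) × (Fin 1 ⊕ Fin c ⊕ Fin c) =>
            (Sum.elim (fun _ => (m : k))
              (Sum.elim (fun _ => (1 : k)) (fun _ => (-1 : k))) p.1)
            * (Sum.elim (fun _ => (m : k))
              (Sum.elim (fun _ => (1 : k)) (fun _ => (-1 : k))) p.2))).Equivalent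
        (QuadraticMap.weightedSumSquares k
          (Sum.elim (fun _ : Fin 1 => (1 : k))
            (Sum.elim (fun _ : Fin ((m ^ 2 - 1) / 2) => (1 : k))
              (fun _ : Fin ((m ^ 2 - 1) / 2) => (-1 : k)))))) ∧
    (∀ c : ℕ, m = 2 * c →
      (QuadraticMap.weightedSumSquares k
          (fun p : (Fin c ⊕ Fin c) × (Fin c ⊕ Fin c) =>
            (Sum.elim (fun _ => (1 : k)) (fun _ => (-1 : k)) p.1)
            * (Sum.elim (fun _ => (1 : k)) (fun _ => (-1 : k)) p.2))).Equivalent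
        (QuadraticMap.weightedSumSquares k
          (Sum.elim (fun _ : Fin (m ^ 2 / 2) => (1 : k))
            (fun _ : Fin (m ^ 2 / 2) => (-1 : k))))) := by
  have h2 : (2 : k) ≠ 0 := Ring.two_ne_zero hk
  constructor
  · rintro c hc
    set u : Fin 1 ⊕ Fin c ⊕ Fin c → k :=
      Sum.elim (fun _ => (m : k)) (Sum.elim (fun _ => 1) (fun _ => -1)) with hu
    have hu0 : ∀ i, u i ≠ 0 := by rintro (i | i | i) <;> simp [hu, hmk]
    let a : Fin c ⊕ Fin c × (Fin 1 ⊕ Fin c ⊕ Fin c) → k := Sum.elim (fun _ => m) (fun p => u p.2)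
    have ha0 : ∀ i, a i ≠ 0 := by rintro (i | i) <;> simp [a, hmk, hu0]
    have hcard : Fintype.card (Fin c ⊕ Fin c × (Fin 1 ⊕ Fin c ⊕ Fin c)) = (m ^ 2 - 1) / 2 := by
      have : m ^ 2 - 1 = 2 * (c + c * (1 + (c + c))) := by
        rw [hc]; apply Nat.sub_eq_of_eq_add; ring
      simp [this]
    let e : (Fin 1 ⊕ Fin c ⊕ Fin c) × (Fin 1 ⊕ Fin c ⊕ Fin c) ≃
        Fin 1 ⊕ ((Fin c ⊕ Fin c × (Fin 1 ⊕ Fin c ⊕ Fin c)) ⊕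
          (Fin c ⊕ Fin c × (Fin 1 ⊕ Fin c ⊕ Fin c))) :=
      (Equiv.sumProdDistrib _ _ _).trans <|
        (((Equiv.uniqueProd _ _).sumCongr (Equiv.sumProdDistrib _ _ _))).trans <|
        (Equiv.sumAssoc _ _ _).trans <| (Equiv.refl _).sumCongr (Equiv.sumSumSumComm _ _ _ _)
    refine (QuadraticMap.weightedSumSquares_equivalent_of_equiv
      (w := Sum.elim (fun _ => (m : k) * m) (Sum.elim a (-a))) e ?_).trans
      (QuadraticMap.weightedSumSquares_sumElim_equivalent ?_
        (QuadraticMap.weightedSumSquares_sumElim_neg_equivalent_fin h2 a ha0 hcard))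
    · rintro ⟨i | i | i, j | j | j⟩ <;> simp [e, a, hu]
    · exact ⟨QuadraticForm.isometryEquivWeightedSumSquaresWeightedSumSquares
        (fun _ => Units.mk0 (m : k) hmk) fun i => by simp [sq]⟩
  · rintro c hc
    set u : Fin c ⊕ Fin c → k := Sum.elim (fun _ => 1) (fun _ => -1) with hu
    have hu0 : ∀ i, u i ≠ 0 := by rintro (i | i) <;> simp [hu]
    have hcard : Fintype.card (Fin c × (Fin c ⊕ Fin c)) = m ^ 2 / 2 := by
      have : m ^ 2 = 2 * (c * (c + c)) := by rw [hc]; ring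
      simp [this]
    refine (QuadraticMap.weightedSumSquares_equivalent_of_equiv
      (w := Sum.elim (fun p => u p.2) (-fun p => u p.2)) (Equiv.sumProdDistrib _ _ _) ?_).trans
      (QuadraticMap.weightedSumSquares_sumElim_neg_equivalent_fin h2 _ (fun p => hu0 p.2) hcard)
    rintro ⟨i | i, j⟩ <;> simp [hu]
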